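/- arXiv:2605.27797 — 10 statements merged into one kernel-verified Lean document; each statement's English description precedes it below -/
import Mathlib

section
/- Let R be a commutative local ring with maximal ideal 𝔪 and residue field k = R/𝔪, and let J be an ideal of R[s]. Suppose b ∈ J is monic (in s) and every monic element of J has degree at least the degree of b. Then every f ∈ J whose degree in s is strictly less than the degree of b has all of its coefficients in 𝔪; equivalently, the coefficientwise residue image of f in k[s] is zero. -/
open Polynomial IsLocalRing in
/-- A polynomial of degree less than `n` over a local ring whose residue image vanishes lies in
the maximal ideal times the module of polynomials of degree less than `n`. -/
theorem mem_maximalIdeal_smul_degreeLT {R : Type*} [CommRing R] [IsLocalRing R] {n : ℕ}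
    {p : R[X]} (hp : p.degree < n) (hp0 : p.map (residue R) = 0) :
    p ∈ maximalIdeal R • degreeLT R n := by
  rw [p.as_sum_support_C_mul_X_pow]
  refine Submodule.sum_mem _ fun i hi => ?_
  rw [← smul_eq_C_mul]
  refine Submodule.smul_mem_smul ?_ ?_
  · rw [← residue_eq_zero_iff, ← coeff_map, hp0, coeff_zero]
  · rw [mem_degreeLT]
    exact (degree_X_pow_le i).trans_lt ((le_degree_of_mem_supp i hi).trans_lt hp)

open Polynomial IsLocalRing in
/-- Let `b` be a monic element of an ideal `J` of `R[X]`, with `R` local. If `f ∈ J` has nonzero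
residue image of degree less than that of `b`, then every polynomial of degree less than that of
`b` is congruent modulo `J` to one of degree less than that of the residue image of `f`. -/
theorem degreeLT_le_degreeLT_sup_of_map_residue_ne_zero {R : Type*} [CommRing R] [IsLocalRing R]
    {J : Ideal R[X]} {b f : R[X]} (hbJ : b ∈ J) (hb : b.Monic) (hfJ : f ∈ J)
    (hf0 : f.map (residue R) ≠ 0) (hfb : (f.map (residue R)).degree < b.degree) :
    degreeLT R b.natDegree ≤
      degreeLT R (f.map (residue R)).natDegree ⊔ J.restrictScalars R := by
  have hbdeg := degree_eq_natDegree hb.ne_zero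
  have hfdeg := degree_eq_natDegree hf0
  have hfg : (degreeLT R b.natDegree).FG := by
    classical
    rw [degreeLT_eq_span_X_pow]
    exact Submodule.fg_span (Finset.finite_toSet _)
  refine Submodule.le_of_le_smul_of_le_jacobson_bot hfg (maximalIdeal_le_jacobson ⊥) ?_
  intro p hp
  rw [mem_degreeLT] at hp
  have hdiv := EuclideanDomain.div_add_mod (p.map (residue R)) (f.map (residue R))
  have hmod : (p.map (residue R) % f.map (residue R)).degree < (f.map (residue R)).degree :=
    EuclideanDomain.mod_lt _ hf0
  obtain ⟨q, hq⟩ := map_surjective (residue R) residue_surjective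
    (p.map (residue R) / f.map (residue R))
  obtain ⟨r, hr, hrdeg⟩ := exists_degree_eq_of_mem_lifts
    (mem_lifts_of_surjective residue_surjective (p.map (residue R) % f.map (residue R)))
  rw [← hq, ← hr] at hdiv
  rw [← hr] at hmod
  have hpdeg : (p.map (residue R)).degree < b.degree :=
    degree_map_le.trans_lt (hbdeg ▸ hp)
  have hprod : (f.map (residue R) * q.map (residue R)).degree < b.degree := by
    rw [eq_sub_of_add_eq hdiv]
    exact (degree_sub_le _ _).trans_lt (max_lt hpdeg (hmod.trans hfb))
  have hrf : r.degree < (f.map (residue R)).degree := by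
    rw [hrdeg, ← hr]
    exact hmod
  have hmap : ((f * q) %ₘ b).map (residue R) = f.map (residue R) * q.map (residue R) := by
    rw [map_modByMonic _ hb, Polynomial.map_mul, modByMonic_eq_self_iff (hb.map _),
      hb.degree_map]
    exact hprod
  have hgJ : (f * q) %ₘ b ∈ J := by
    rw [modByMonic_eq_sub_mul_div]
    exact J.sub_mem (J.mul_mem_right _ hfJ) (J.mul_mem_right _ hbJ)
  have hsmul : p - (r + (f * q) %ₘ b) ∈ maximalIdeal R • degreeLT R b.natDegree := by
    refine mem_maximalIdeal_smul_degreeLT ?_ ?_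
    · rw [← hbdeg] at hp ⊢
      exact (degree_sub_le _ _).trans_lt (max_lt hp ((degree_add_le _ _).trans_lt
        (max_lt (hrf.trans hfb) (degree_modByMonic_lt _ hb))))
    · rw [Polynomial.map_sub, Polynomial.map_add, hmap, ← hdiv]
      ring
  rw [← add_sub_cancel (r + (f * q) %ₘ b) p]
  refine Submodule.add_mem_sup (Submodule.add_mem_sup ?_ hgJ) hsmul
  rw [mem_degreeLT, ← hfdeg]
  exact hrf

/-- If `b` is a monic element of an ideal `J` of `R[s]` (`R` a commutative local ring)
of minimal degree among the monic elements of `J`, then every `f ∈ J` of degree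
strictly less than that of `b` has all coefficients in the maximal ideal, i.e. its
coefficientwise residue image in `k[s]` vanishes. -/
theorem stmt_0 (R : Type*) [CommRing R] [IsLocalRing R]
    (J : Ideal (Polynomial R)) (b : Polynomial R)
    (hbJ : b ∈ J) (hb : b.Monic)
    (hmin : ∀ g ∈ J, g.Monic → b.degree ≤ g.degree) :
    ∀ f ∈ J, f.degree < b.degree →
      Polynomial.map (IsLocalRing.residue R) f = 0 := by
  intro f hfJ hfb
  by_contra hf0
  have hfb' := (Polynomial.degree_map_le (f := IsLocalRing.residue R)).trans_lt hfb
  have hle := degreeLT_le_degreeLT_sup_of_map_residue_ne_zero hbJ hb hfJ hf0 hfb'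
  rw [Polynomial.degree_eq_natDegree hf0] at hfb'
  set e := (Polynomial.map (IsLocalRing.residue R) f).natDegree
  have hX : (Polynomial.X ^ e : Polynomial R) ∈ Polynomial.degreeLT R b.natDegree := by
    rw [Polynomial.mem_degreeLT, Polynomial.degree_X_pow,
      ← Polynomial.degree_eq_natDegree hb.ne_zero]
    exact hfb'
  obtain ⟨r, hr, g, hg, hrg⟩ := Submodule.mem_sup.mp (hle hX)
  rw [Polynomial.mem_degreeLT] at hr
  obtain rfl : g = Polynomial.X ^ e - r := eq_sub_of_add_eq' hrg
  have hdeg : (Polynomial.X ^ e - r).degree ≤ (e : WithBot ℕ) :=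
    (Polynomial.degree_sub_le _ _).trans (max_le (Polynomial.degree_X_pow_le e) hr.le)
  exact (hmin _ hg (Polynomial.monic_X_pow_sub hr)).not_gt (hdeg.trans_lt hfb')
end

section
/- Let R be a commutative local ring with maximal ideal 𝔪 and residue field k = R/𝔪, and let J be an ideal of R[s]. If b and b′ are monic elements of J each of whose degrees is minimal among the degrees of monic elements of J, then the coefficientwise residue images of b and b′ in k[s] are equal. (Uniqueness of the specialization of an indicial polynomial.) -/
open Polynomial in
/-- If an ideal `J` of `R[X]`, with `R` local, contains a monic polynomial, then every monic
polynomial whose residue lies in the residue of `J` has the degree of a monic element of `J`. -/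
theorem exists_monic_mem_degree_eq_of_map_residue_mem {R : Type*} [CommRing R] [IsLocalRing R]
    {J : Ideal R[X]} {b : R[X]} (hbJ : b ∈ J) (hb : b.Monic) {g : R[X]} (hg : g.Monic)
    (hgJ : g.map (IsLocalRing.residue R) ∈ J.map (mapRingHom (IsLocalRing.residue R))) :
    ∃ p ∈ J, p.Monic ∧ p.degree = g.degree := by
  have hgm : g ∈ J ⊔ (IsLocalRing.maximalIdeal R).map C := by
    rw [← IsLocalRing.ker_residue, ← ker_mapRingHom, ← Ideal.comap_map_of_surjective'
      _ (map_surjective _ IsLocalRing.residue_surjective)]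
    exact hgJ
  obtain ⟨j, hj, t, ht, hjt⟩ := Submodule.mem_sup.1 hgm
  let φ : R[X] →ₗ[R] R[X] ⧸ J := (Ideal.Quotient.mkₐ R J).toLinearMap
  have hφ (f : R[X]) : φ f = 0 ↔ f ∈ J := Ideal.Quotient.eq_zero_iff_mem
  have hφs : Function.Surjective φ := Ideal.Quotient.mk_surjective
  have : Module.Finite R (R[X] ⧸ J) := by
    have := hb.finite_quotient
    have hle : Ideal.span {b} ≤ J := (Ideal.span_singleton_le_iff_mem J).2 hbJ
    exact .of_surjective (Ideal.Quotient.factorₐ R hle).toLinearMap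
      (Ideal.Quotient.factor_surjective hle)
  have htop : (⊤ : Submodule R (R[X] ⧸ J)) ≤ (degreeLT R g.natDegree).map φ := by
    refine Submodule.le_of_le_smul_of_le_jacobson_bot Module.Finite.fg_top
      (IsLocalRing.maximalIdeal_le_jacobson _) fun x _ ↦ ?_
    obtain ⟨f, rfl⟩ := hφs x
    have hf : φ f = φ (f %ₘ g) + φ (t * (f /ₘ g)) := by
      rw [← map_add, ← sub_eq_zero, ← map_sub, hφ]
      have : f - (f %ₘ g + t * (f /ₘ g)) = j * (f /ₘ g) := by
        linear_combination -(modByMonic_add_div f g) - (f /ₘ g) * hjt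
      exact this ▸ J.mul_mem_right _ hj
    rw [hf]
    refine Submodule.add_mem_sup (Submodule.mem_map_of_mem ?_) ?_
    · rw [mem_degreeLT, ← degree_eq_natDegree hg.ne_zero]
      exact degree_modByMonic_lt _ hg
    · have hm : t * (f /ₘ g) ∈ IsLocalRing.maximalIdeal R • (⊤ : Submodule R R[X]) := by
        rw [Ideal.smul_top_eq_map]
        exact Ideal.mul_mem_right _ _ ht
      have := Submodule.mem_map_of_mem (f := φ) hm
      rw [Submodule.map_smul''] at this
      exact Submodule.smul_mono le_rfl le_top this
  obtain ⟨r, hr, hrφ⟩ := htop (Submodule.mem_top (x := φ (X ^ g.natDegree)))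
  have hr' : r.degree < (X ^ g.natDegree : R[X]).degree := by
    rw [degree_X_pow]; exact mem_degreeLT.1 hr
  refine ⟨X ^ g.natDegree - r, ?_, (monic_X_pow _).sub_of_left hr', ?_⟩
  · rw [← hφ, map_sub, hrφ, sub_self]
  · rw [degree_sub_eq_left_of_degree_lt hr', degree_X_pow, degree_eq_natDegree hg.ne_zero]

/-- Uniqueness of the specialization of an indicial polynomial: two monic elements of
an ideal `J` of `R[s]` (`R` a commutative local ring) each of minimal degree among the
monic elements of `J` have equal coefficientwise residue images in `k[s]`. -/
theorem stmt_1 (R : Type*) [CommRing R] [IsLocalRing R]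
    (J : Ideal (Polynomial R)) (b b' : Polynomial R)
    (hbJ : b ∈ J) (hb : b.Monic)
    (hbmin : ∀ g ∈ J, g.Monic → b.degree ≤ g.degree)
    (hb'J : b' ∈ J) (hb' : b'.Monic)
    (hb'min : ∀ g ∈ J, g.Monic → b'.degree ≤ g.degree) :
    Polynomial.map (IsLocalRing.residue R) b = Polynomial.map (IsLocalRing.residue R) b' := by
  set ρ := IsLocalRing.residue R
  by_contra hne
  have hd : (b.map ρ - b'.map ρ).degree < b.degree := by
    rw [← hb.degree_map ρ]
    refine Polynomial.degree_sub_lt_left ?_ (hb.map ρ).ne_zero ?_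
    · rw [hb.degree_map, hb'.degree_map]
      exact le_antisymm (hbmin _ hb'J hb') (hb'min _ hbJ hb)
    · rw [(hb.map ρ).leadingCoeff, (hb'.map ρ).leadingCoeff]
  have h0 : b.map ρ - b'.map ρ ≠ 0 := sub_ne_zero.2 hne
  obtain ⟨g, hgmap, hgdeg, hg⟩ := Polynomial.lifts_and_degree_eq_and_monic
    (Polynomial.mem_lifts _ |>.2 (Polynomial.map_surjective ρ IsLocalRing.residue_surjective _))
    (Polynomial.monic_mul_leadingCoeff_inv h0)
  have hgJ : g.map ρ ∈ J.map (Polynomial.mapRingHom ρ) := by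
    rw [hgmap, ← Polynomial.map_sub]
    exact Ideal.mul_mem_right _ _ (Ideal.mem_map_of_mem _ (J.sub_mem hbJ hb'J))
  obtain ⟨p, hpJ, hp, hpdeg⟩ := exists_monic_mem_degree_eq_of_map_residue_mem hbJ hb hg hgJ
  refine (hbmin p hpJ hp).not_gt ?_
  rwa [hpdeg, hgdeg, Polynomial.degree_mul_leadingCoeff_inv _ h0]
end

section
/- Let R be a commutative local ring with maximal ideal 𝔪 and residue field k = R/𝔪, let J be an ideal of R[s], and let b ∈ J be monic with degree minimal among the degrees of monic elements of J. Then for every f ∈ J, the residue image of b in k[s] divides the residue image of f in k[s]. -/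
open Polynomial in
/-- A polynomial whose coefficients all lie in `I` belongs to `I • ⊤`. -/
theorem Polynomial.mem_smul_top_of_coeff_mem {R : Type*} [CommRing R] (I : Ideal R) (p : R[X])
    (hp : ∀ i, p.coeff i ∈ I) : p ∈ I • (⊤ : Submodule R R[X]) := by
  rw [p.as_sum_support]
  refine Submodule.sum_mem _ fun i _ => ?_
  rw [← mul_one (p.coeff i), ← smul_eq_mul, ← smul_monomial]
  exact Submodule.smul_mem_smul (hp i) Submodule.mem_top

open Polynomial in
/-- Division by a polynomial with nonzero residue, modulo the maximal ideal. -/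
theorem Polynomial.exists_sub_sub_mem_maximalIdeal_smul_top {R : Type*} [CommRing R]
    [IsLocalRing R] (r : R[X]) (hr : r.map (IsLocalRing.residue R) ≠ 0) (p : R[X]) :
    ∃ q c : R[X], c.degree < (r.map (IsLocalRing.residue R)).degree ∧
      p - r * q - c ∈ IsLocalRing.maximalIdeal R • (⊤ : Submodule R R[X]) := by
  have hsurj := IsLocalRing.residue_surjective (R := R)
  obtain ⟨q, hq⟩ := Polynomial.map_surjective _ hsurj
    (p.map (IsLocalRing.residue R) / r.map (IsLocalRing.residue R))
  obtain ⟨c, hc, hcdeg⟩ := exists_degree_eq_of_mem_lifts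
    ((mem_lifts _).2 (Polynomial.map_surjective _ hsurj
      (p.map (IsLocalRing.residue R) % r.map (IsLocalRing.residue R))))
  refine ⟨q, c, hcdeg ▸ EuclideanDomain.mod_lt _ hr, mem_smul_top_of_coeff_mem _ _ fun i => ?_⟩
  have h0 : (p - r * q - c).map (IsLocalRing.residue R) = 0 := by
    rw [Polynomial.map_sub, Polynomial.map_sub, Polynomial.map_mul, hq, hc, sub_sub,
      EuclideanDomain.div_add_mod, sub_self]
  rw [← IsLocalRing.residue_eq_zero_iff, ← coeff_map, h0, coeff_zero]

open Polynomial in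
/-- If an ideal of `R[X]` contains a monic `b` and an `r` whose residue is nonzero of degree
`e < deg b`, then it contains a monic polynomial of degree `e`. -/
theorem Polynomial.exists_monic_mem_degree_eq_degree_map_residue {R : Type*} [CommRing R]
    [IsLocalRing R] (J : Ideal R[X]) {b r : R[X]} (hbJ : b ∈ J) (hb : b.Monic) (hrJ : r ∈ J)
    (hr : r.map (IsLocalRing.residue R) ≠ 0)
    (hlt : (r.map (IsLocalRing.residue R)).degree < b.degree) :
    ∃ g ∈ J, g.Monic ∧ g.degree = (r.map (IsLocalRing.residue R)).degree := by
  set e := (r.map (IsLocalRing.residue R)).natDegree with he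
  have hdeg : (r.map (IsLocalRing.residue R)).degree = e := degree_eq_natDegree hr
  rw [hdeg, degree_eq_natDegree hb.ne_zero] at hlt
  have hbdeg := degree_eq_natDegree hb.ne_zero
  have key : degreeLT R b.natDegree ≤ degreeLT R e ⊔ J.restrictScalars R := by
    refine Submodule.le_of_le_smul_of_le_jacobson_bot (I := IsLocalRing.maximalIdeal R) ?_
      (IsLocalRing.jacobson_eq_maximalIdeal ⊥ bot_ne_top).ge ?_
    · classical
      rw [degreeLT_eq_span_X_pow]
      exact ⟨_, rfl⟩
    · intro p _
      obtain ⟨q, c, hc, ht⟩ := exists_sub_sub_mem_maximalIdeal_smul_top r hr p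
      set t := p - r * q - c with htdef
      have hmod : t %ₘ b ∈ IsLocalRing.maximalIdeal R • degreeLT R b.natDegree := by
        have h := Submodule.mem_map_of_mem (f := modByMonicHom b) ht
        rw [Submodule.map_smul''] at h
        refine Submodule.smul_mono le_rfl ?_ h
        rintro _ ⟨x, _, rfl⟩
        rw [mem_degreeLT, ← hbdeg]
        exact degree_modByMonic_lt x hb
      have hp : p = (c + (r * q + b * (t /ₘ b))) + t %ₘ b := by
        linear_combination (- modByMonic_add_div t b) - htdef
      rw [hp]
      exact Submodule.add_mem_sup (Submodule.add_mem_sup (mem_degreeLT.2 (hdeg ▸ hc))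
        (J.add_mem (J.mul_mem_right _ hrJ) (J.mul_mem_right _ hbJ))) hmod
  have hX : (X ^ e : R[X]) ∈ degreeLT R b.natDegree := by
    rw [mem_degreeLT, degree_X_pow]
    exact hlt
  obtain ⟨c, hc, g, hg, hcg⟩ := Submodule.mem_sup.1 (key hX)
  rw [mem_degreeLT] at hc
  obtain rfl : g = X ^ e - c := eq_sub_of_add_eq' hcg
  refine ⟨_, hg, monic_X_pow_sub hc, ?_⟩
  rw [hdeg, degree_sub_eq_left_of_degree_lt (by rwa [degree_X_pow]), degree_X_pow]

/-- If `b` is a monic element of an ideal `J` of `R[s]` (`R` a commutative local ring)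
of minimal degree among the monic elements of `J`, then for every `f ∈ J` the residue
image of `b` in `k[s]` divides the residue image of `f`. -/
theorem stmt_2 (R : Type*) [CommRing R] [IsLocalRing R]
    (J : Ideal (Polynomial R)) (b : Polynomial R)
    (hbJ : b ∈ J) (hb : b.Monic)
    (hmin : ∀ g ∈ J, g.Monic → b.degree ≤ g.degree) :
    ∀ f ∈ J, Polynomial.map (IsLocalRing.residue R) b ∣
      Polynomial.map (IsLocalRing.residue R) f := by
  intro f hf
  have hrJ : f.modByMonic b ∈ J := by
    rw [Polynomial.modByMonic_eq_sub_mul_div]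
    exact J.sub_mem hf (J.mul_mem_right _ hbJ)
  have hr : Polynomial.map (IsLocalRing.residue R) (f.modByMonic b) = 0 := by
    by_contra hr
    have hlt := (Polynomial.degree_map_le (f := IsLocalRing.residue R)).trans_lt
      (Polynomial.degree_modByMonic_lt f hb)
    obtain ⟨g, hgJ, hg, hdeg⟩ :=
      Polynomial.exists_monic_mem_degree_eq_degree_map_residue J hbJ hb hrJ hr hlt
    exact (hmin g hgJ hg).not_gt (hdeg ▸ hlt)
  rw [← Polynomial.modByMonic_add_div f b, Polynomial.map_add, hr, zero_add, Polynomial.map_mul]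
  exact dvd_mul_right _ _
end

section
/- Let k be a field and R a commutative local k-algebra with maximal ideal 𝔪, and let J be an ideal of R[s]. Suppose b ∈ k[s] is monic, the coefficientwise image of b in R[s] (via the algebra map k → R) belongs to J, and every monic element of J has degree at least the degree of b (i.e., the image of b is a monic element of J of minimal degree with constant coefficients). Then the set {f ∈ k[s] : the coefficientwise image of f in R[s] belongs to J} is exactly the principal ideal of k[s] generated by b. (An indicial polynomial with constant coefficients is the b-function.) -/
/-- An indicial polynomial with constant coefficients is the b-function: if `b ∈ k[s]` is
monic, its coefficientwise image in `R[s]` belongs to the ideal `J`, and every monic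
element of `J` has degree at least `deg b`, then the set of `f ∈ k[s]` whose image lies
in `J` is exactly the principal ideal generated by `b`. -/
theorem stmt_5 (k : Type*) [Field k]
    (R : Type*) [CommRing R] [IsLocalRing R] [Algebra k R]
    (J : Ideal (Polynomial R))
    (b : Polynomial k) (hb : b.Monic)
    (hbJ : Polynomial.map (algebraMap k R) b ∈ J)
    (hmin : ∀ g ∈ J, g.Monic → b.degree ≤ g.degree) :
    ∀ f : Polynomial k,
      Polynomial.map (algebraMap k R) f ∈ J ↔ f ∈ Ideal.span {b} := by
  intro f
  rw [Ideal.mem_span_singleton]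
  constructor
  · intro hf
    rw [← Polynomial.modByMonic_eq_zero_iff_dvd hb]
    by_contra hr
    have hrJ : Polynomial.map (algebraMap k R) (f %ₘ b) ∈ J := by
      rw [Polynomial.modByMonic_eq_sub_mul_div f b, Polynomial.map_sub, Polynomial.map_mul]
      exact J.sub_mem hf (J.mul_mem_right _ hbJ)
    have hmonic : (f %ₘ b * Polynomial.C (f %ₘ b).leadingCoeff⁻¹).Monic :=
      Polynomial.monic_mul_leadingCoeff_inv hr
    have hle := hmin (Polynomial.map (algebraMap k R)
        (f %ₘ b * Polynomial.C (f %ₘ b).leadingCoeff⁻¹))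
      (by rw [Polynomial.map_mul]; exact J.mul_mem_right _ hrJ) (hmonic.map _)
    rw [hmonic.degree_map, Polynomial.degree_mul_leadingCoeff_inv _ hr] at hle
    exact absurd (Polynomial.degree_modByMonic_lt f hb) hle.not_gt
  · rintro ⟨q, rfl⟩
    rw [Polynomial.map_mul]
    exact J.mul_mem_right _ hbJ
end

section
/- Let K be a field of characteristic zero, L an extension field of K, n a natural number, and J an ideal of K[x][s]. Suppose b ∈ K[s] is monic and the ideal {f ∈ K[s] : f, regarded in K[x][s], belongs to J} of K[s] equals the principal ideal generated by b (that is, b is the global b-function). Then: (a) for every prime ideal 𝔭 of L[x] and every monic g ∈ L[s] that generates the local b-ideal of J_L at 𝔭, g divides the image of b in L[s]; and (b) for every monic c ∈ L[s], if c belongs to the local b-ideal of J_L at every maximal ideal of L[x], then the image of b in L[s] divides c. Consequently, the image of b in L[s] is the least common multiple of the b-functions of J_L at the maximal ideals of L[x]. -/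
theorem Polynomial.coeff_sum_support_monomial {A B : Type*} [Semiring A] [Semiring B]
    (ψ : B →+ A) (p : Polynomial B) (i : ℕ) :
    (∑ j ∈ p.support, Polynomial.monomial j (ψ (p.coeff j))).coeff i = ψ (p.coeff i) := by
  rw [Polynomial.finsetSum_coeff]
  simp +contextual [Polynomial.coeff_monomial]

/-- Apply an additive map to every coefficient of a polynomial. -/
noncomputable def Polynomial.mapCoeffs {A B : Type*} [Semiring A] [Semiring B] (ψ : B →+ A) :
    Polynomial B →+ Polynomial A where
  toFun p := ∑ i ∈ p.support, Polynomial.monomial i (ψ (p.coeff i))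
  map_zero' := by simp
  map_add' p q := by
    ext i
    rw [Polynomial.coeff_add]
    iterate 3 rw [Polynomial.coeff_sum_support_monomial]
    rw [Polynomial.coeff_add, map_add]

theorem Polynomial.coeff_mapCoeffs {A B : Type*} [Semiring A] [Semiring B] (ψ : B →+ A)
    (p : Polynomial B) (i : ℕ) : (Polynomial.mapCoeffs ψ p).coeff i = ψ (p.coeff i) :=
  Polynomial.coeff_sum_support_monomial ψ p i

theorem Polynomial.mapCoeffs_map_mul {A B : Type*} [Semiring A] [Semiring B] (f : A →+* B)
    (ψ : B →+ A) (hψ : ∀ a b, ψ (f a * b) = a * ψ b) (p : Polynomial A) (q : Polynomial B) :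
    Polynomial.mapCoeffs ψ (p.map f * q) = p * Polynomial.mapCoeffs ψ q := by
  ext i
  simp [Polynomial.coeff_mapCoeffs, Polynomial.coeff_mul, hψ]

theorem MvPolynomial.coeff_sum_support_monomial {σ A B : Type*} [CommSemiring A]
    [CommSemiring B] (ψ : B →+ A) (p : MvPolynomial σ B) (i : σ →₀ ℕ) :
    (∑ j ∈ p.support, MvPolynomial.monomial j (ψ (p.coeff j))).coeff i = ψ (p.coeff i) := by
  classical
  rw [MvPolynomial.coeff_sum]
  simp +contextual [MvPolynomial.coeff_monomial]

/-- Apply an additive map to every coefficient of a multivariate polynomial. -/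
noncomputable def MvPolynomial.mapCoeffs {σ A B : Type*} [CommSemiring A] [CommSemiring B]
    (ψ : B →+ A) : MvPolynomial σ B →+ MvPolynomial σ A where
  toFun p := ∑ i ∈ p.support, MvPolynomial.monomial i (ψ (p.coeff i))
  map_zero' := by simp
  map_add' p q := by
    ext i
    rw [MvPolynomial.coeff_add]
    iterate 3 rw [MvPolynomial.coeff_sum_support_monomial]
    rw [MvPolynomial.coeff_add, map_add]

theorem MvPolynomial.coeff_mapCoeffs {σ A B : Type*} [CommSemiring A] [CommSemiring B]
    (ψ : B →+ A) (p : MvPolynomial σ B) (i : σ →₀ ℕ) :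
    (MvPolynomial.mapCoeffs ψ p).coeff i = ψ (p.coeff i) :=
  MvPolynomial.coeff_sum_support_monomial ψ p i

theorem MvPolynomial.mapCoeffs_map_mul {σ A B : Type*} [CommSemiring A] [CommSemiring B]
    (f : A →+* B) (ψ : B →+ A) (hψ : ∀ a b, ψ (f a * b) = a * ψ b)
    (p : MvPolynomial σ A) (q : MvPolynomial σ B) :
    MvPolynomial.mapCoeffs ψ (MvPolynomial.map f p * q) = p * MvPolynomial.mapCoeffs ψ q := by
  classical
  ext i
  simp [MvPolynomial.coeff_mapCoeffs, MvPolynomial.coeff_mul, MvPolynomial.coeff_map, hψ]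

theorem MvPolynomial.mapCoeffs_C {σ A B : Type*} [CommSemiring A] [CommSemiring B]
    (ψ : B →+ A) (b : B) :
    MvPolynomial.mapCoeffs ψ (MvPolynomial.C (σ := σ) b) = MvPolynomial.C (ψ b) := by
  classical
  ext i
  rw [MvPolynomial.coeff_mapCoeffs, MvPolynomial.coeff_C, MvPolynomial.coeff_C]
  split_ifs <;> simp

/-- A map of coefficients that is linear along `f` sends the extension of an ideal of
polynomials back into the ideal. -/
theorem Polynomial.mapCoeffs_mem_of_mem_map {A B : Type*} [CommSemiring A] [CommSemiring B]
    (f : A →+* B) (ψ : B →+ A) (hψ : ∀ a b, ψ (f a * b) = a * ψ b)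
    {J : Ideal (Polynomial A)} {q : Polynomial B}
    (hq : q ∈ J.map (Polynomial.mapRingHom f)) : Polynomial.mapCoeffs ψ q ∈ J := by
  suffices h : ∀ r : Polynomial B, Polynomial.mapCoeffs ψ (r * q) ∈ J by simpa using h 1
  induction hq using Submodule.span_induction with
  | mem x hx =>
    obtain ⟨p, hp, rfl⟩ := hx
    intro r
    rw [Polynomial.coe_mapRingHom, mul_comm, Polynomial.mapCoeffs_map_mul f ψ hψ]
    exact J.mul_mem_right _ hp
  | zero => simp
  | add x y _ _ hx hy =>
    intro r
    rw [mul_add, map_add]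
    exact J.add_mem (hx r) (hy r)
  | smul t x _ hx =>
    intro r
    rw [smul_eq_mul, ← mul_assoc]
    exact hx (r * t)

/-- An element lies in an ideal of `A[X]` as soon as it does so locally at every maximal ideal
of `A`. -/
theorem Polynomial.mem_of_forall_isMaximal_exists_C_mul_mem {A : Type*} [CommRing A]
    {I : Ideal (Polynomial A)} {q : Polynomial A}
    (h : ∀ m : Ideal A, m.IsMaximal → ∃ a, a ∉ m ∧ Polynomial.C a * q ∈ I) : q ∈ I := by
  have htop : (I.colon {q}).comap (Polynomial.C : A →+* Polynomial A) = ⊤ := by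
    by_contra hne
    obtain ⟨m, hm, hle⟩ := Ideal.exists_le_maximal _ hne
    obtain ⟨a, ham, ha⟩ := h m hm
    exact ham (hle (by simpa [Submodule.mem_colon_singleton] using ha))
  have hone := (Ideal.eq_top_iff_one _).1 htop
  simpa [Submodule.mem_colon_singleton] using hone

/-- Divisibility by a monic polynomial over a subfield can be tested on the images under all
linear functionals. -/
theorem Polynomial.map_dvd_of_forall_dual_dvd {K L : Type*} [Field K] [Field L] [Algebra K L]
    {b : Polynomial K} (hb : b.Monic) {c : Polynomial L}
    (h : ∀ φ : Module.Dual K L, b ∣ Polynomial.mapCoeffs φ.toAddMonoidHom c) :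
    b.map (algebraMap K L) ∣ c := by
  have hbL := hb.map (algebraMap K L)
  rw [← Polynomial.modByMonic_eq_zero_iff_dvd hbL]
  set r := c %ₘ b.map (algebraMap K L) with hr
  ext i
  rw [Polynomial.coeff_zero, ← Module.forall_dual_apply_eq_zero_iff K]
  intro φ
  have hφ : ∀ a x, φ.toAddMonoidHom (algebraMap K L a * x) = a * φ.toAddMonoidHom x := by
    intro a x
    simp [← Algebra.smul_def]
  have hdvd : b ∣ Polynomial.mapCoeffs φ.toAddMonoidHom r := by
    have hsum := congrArg (Polynomial.mapCoeffs φ.toAddMonoidHom)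
      (Polynomial.modByMonic_add_div c (b.map (algebraMap K L)))
    rw [map_add, Polynomial.mapCoeffs_map_mul _ _ hφ] at hsum
    have hc := h φ
    rw [← hsum] at hc
    exact (dvd_add_left (dvd_mul_right _ _)).1 hc
  have hzero : Polynomial.mapCoeffs φ.toAddMonoidHom r = 0 := by
    refine Polynomial.eq_zero_of_dvd_of_degree_lt hdvd ?_
    have hlt : r.degree < b.degree := by
      simpa using Polynomial.degree_modByMonic_lt c hbL
    refine lt_of_le_of_lt ((Polynomial.degree_le_iff_coeff_zero _ _).2 fun j hj => ?_) hlt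
    rw [Polynomial.coeff_mapCoeffs, Polynomial.coeff_eq_zero_of_degree_lt hj, map_zero]
  simpa [Polynomial.coeff_mapCoeffs] using congrArg (fun p => p.coeff i) hzero


/-- The global b-function is the least common multiple of the local b-functions:
if `b ∈ K[s]` is the monic generator of `{f ∈ K[s] : f ∈ J}` (`J` an ideal of
`K[x][s]`), then (a) the b-function of `J_L` at any prime ideal `𝔭` of `L[x]`
divides the image of `b` in `L[s]`, and (b) any monic `c ∈ L[s]` lying in the local
b-ideal of `J_L` at every maximal ideal of `L[x]` is divisible by the image of `b`. -/
theorem stmt_6 (K L : Type*) [Field K] [CharZero K] [Field L] [Algebra K L] (n : ℕ)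
    (J : Ideal (Polynomial (MvPolynomial (Fin n) K)))
    (b : Polynomial K) (hb : b.Monic)
    (hglob : ∀ f : Polynomial K,
      Polynomial.map (MvPolynomial.C : K →+* MvPolynomial (Fin n) K) f ∈ J ↔
        f ∈ Ideal.span {b}) :
    (∀ 𝔭 : Ideal (MvPolynomial (Fin n) L), 𝔭.IsPrime →
      ∀ g : Polynomial L, g.Monic →
        (∀ f : Polynomial L,
          (∃ a, a ∉ 𝔭 ∧ Polynomial.C a *
              Polynomial.map (MvPolynomial.C : L →+* MvPolynomial (Fin n) L) f ∈
                J.map (Polynomial.mapRingHom (MvPolynomial.map (algebraMap K L)))) ↔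
            f ∈ Ideal.span {g}) →
        g ∣ Polynomial.map (algebraMap K L) b) ∧
    (∀ c : Polynomial L, c.Monic →
      (∀ 𝔪 : Ideal (MvPolynomial (Fin n) L), 𝔪.IsMaximal →
        ∃ a, a ∉ 𝔪 ∧ Polynomial.C a *
            Polynomial.map (MvPolynomial.C : L →+* MvPolynomial (Fin n) L) c ∈
              J.map (Polynomial.mapRingHom (MvPolynomial.map (algebraMap K L)))) →
      Polynomial.map (algebraMap K L) b ∣ c) := by
  refine ⟨fun 𝔭 h𝔭 g _ hloc => ?_, fun c _ hc => ?_⟩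
  · rw [← Ideal.mem_span_singleton, ← hloc]
    refine ⟨1, fun h => h𝔭.ne_top ((Ideal.eq_top_iff_one _).2 h), ?_⟩
    have hbJ := Ideal.mem_map_of_mem (Polynomial.mapRingHom (MvPolynomial.map (algebraMap K L)))
      ((hglob b).2 (Ideal.mem_span_singleton_self b))
    have hcomp : (MvPolynomial.map (σ := Fin n) (algebraMap K L)).comp MvPolynomial.C =
        MvPolynomial.C.comp (algebraMap K L) := by
      ext1 a
      simp
    rw [Polynomial.coe_mapRingHom, Polynomial.map_map, hcomp] at hbJ
    simpa [Polynomial.map_map] using hbJ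
  · have hcJ := Polynomial.mem_of_forall_isMaximal_exists_C_mul_mem hc
    refine Polynomial.map_dvd_of_forall_dual_dvd hb fun φ => ?_
    rw [← Ideal.mem_span_singleton, ← hglob]
    have hφ : ∀ a x, φ.toAddMonoidHom (algebraMap K L a * x) = a * φ.toAddMonoidHom x := by
      intro a x
      simp [← Algebra.smul_def]
    convert Polynomial.mapCoeffs_mem_of_mem_map _ (MvPolynomial.mapCoeffs φ.toAddMonoidHom)
      (MvPolynomial.mapCoeffs_map_mul _ _ hφ) hcJ using 1
    ext1 i
    simp only [Polynomial.coeff_map, Polynomial.coeff_mapCoeffs, MvPolynomial.mapCoeffs_C]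
end

section
/- Let K be a field of characteristic zero, L an extension field of K, n a natural number, and J an ideal of K[x][s]. Then the ideal {f ∈ L[s] : f, regarded in L[x][s], belongs to J_L} of L[s] equals the ideal of L[s] generated by the images under the base-change map K[s] → L[s] of the elements of {f ∈ K[s] : f, regarded in K[x][s], belongs to J}. (Base change commutes with intersecting with the constant-coefficient polynomial subring: L⊗_K J ∩ L[s] = L⊗_K (J ∩ K[s]).) -/
/-- An additive map `ψ : B → A` that is linear along a ring homomorphism `h : A → B` sends
the extension of an ideal `J` of `A` back into `J`. -/
theorem Ideal.apply_mem_of_mem_map_of_linear_along {A B : Type*} [CommRing A] [CommRing B]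
    (h : A →+* B) (ψ : B →+ A) (hψ : ∀ a b, ψ (b * h a) = ψ b * a) (J : Ideal A) {b : B}
    (hb : b ∈ J.map h) : ψ b ∈ J := by
  have hsmul : ∀ c, ψ (c * b) ∈ J := by
    induction hb using Submodule.span_induction with
    | mem x hx =>
      obtain ⟨a, ha, rfl⟩ := hx
      intro c
      rw [hψ]
      exact J.mul_mem_left _ ha
    | zero => simp
    | add x y _ _ hx hy =>
      intro c
      rw [mul_add, map_add]
      exact J.add_mem (hx c) (hy c)
    | smul d x _ hx =>
      intro c
      rw [smul_eq_mul, ← mul_assoc]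
      exact hx _
  simpa using hsmul 1

/-- The additive map on polynomials applying an additive map to every coefficient. -/
noncomputable def Polynomial.mapAddMonoidHom {A B : Type*} [CommRing A] [CommRing B]
    (ψ : B →+ A) : Polynomial B →+ Polynomial A where
  toFun p := p.sum fun n b => Polynomial.monomial n (ψ b)
  map_zero' := by simp
  map_add' p q := Polynomial.sum_add_index p q _ (by simp) (by simp)

theorem Polynomial.mapAddMonoidHom_monomial {A B : Type*} [CommRing A] [CommRing B]
    (ψ : B →+ A) (n : ℕ) (b : B) :
    Polynomial.mapAddMonoidHom ψ (Polynomial.monomial n b) = Polynomial.monomial n (ψ b) :=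
  Polynomial.sum_monomial_index b (fun n b => Polynomial.monomial n (ψ b)) (by simp)

theorem Polynomial.mapAddMonoidHom_mul_map {A B : Type*} [CommRing A] [CommRing B]
    (h : A →+* B) (ψ : B →+ A) (hψ : ∀ a b, ψ (b * h a) = ψ b * a)
    (q : Polynomial A) (p : Polynomial B) :
    Polynomial.mapAddMonoidHom ψ (p * q.map h) = Polynomial.mapAddMonoidHom ψ p * q := by
  induction p using Polynomial.induction_on' with
  | add p₁ p₂ h₁ h₂ => simp only [add_mul, map_add, h₁, h₂]
  | monomial m b =>
    induction q using Polynomial.induction_on' with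
    | add q₁ q₂ h₁ h₂ => simp only [Polynomial.map_add, mul_add, map_add, h₁, h₂]
    | monomial n a =>
      simp only [Polynomial.map_monomial, Polynomial.monomial_mul_monomial,
        Polynomial.mapAddMonoidHom_monomial, hψ]

/-- The additive map on multivariate polynomials applying an additive map to every
coefficient. -/
noncomputable def MvPolynomial.mapAddMonoidHom {σ A B : Type*} [CommRing A] [CommRing B]
    (ψ : B →+ A) : MvPolynomial σ B →+ MvPolynomial σ A where
  toFun := AddMonoidAlgebra.map ψ
  map_zero' := AddMonoidAlgebra.map_zero ψ
  map_add' := AddMonoidAlgebra.map_add ψ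

theorem MvPolynomial.mapAddMonoidHom_monomial {σ A B : Type*} [CommRing A] [CommRing B]
    (ψ : B →+ A) (m : σ →₀ ℕ) (b : B) :
    MvPolynomial.mapAddMonoidHom ψ (MvPolynomial.monomial m b) =
      MvPolynomial.monomial m (ψ b) :=
  AddMonoidAlgebra.map_single ψ b m

theorem MvPolynomial.mapAddMonoidHom_mul_map {σ A B : Type*} [CommRing A] [CommRing B]
    (h : A →+* B) (ψ : B →+ A) (hψ : ∀ a b, ψ (b * h a) = ψ b * a)
    (q : MvPolynomial σ A) (p : MvPolynomial σ B) :
    MvPolynomial.mapAddMonoidHom ψ (p * MvPolynomial.map h q) =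
      MvPolynomial.mapAddMonoidHom ψ p * q := by
  induction p using MvPolynomial.induction_on' with
  | add p₁ p₂ h₁ h₂ => simp only [add_mul, map_add, h₁, h₂]
  | monomial m b =>
    induction q using MvPolynomial.induction_on' with
    | add q₁ q₂ h₁ h₂ => simp only [mul_add, map_add, h₁, h₂]
    | monomial n a =>
      simp only [MvPolynomial.map_monomial, MvPolynomial.monomial_mul,
        MvPolynomial.mapAddMonoidHom_monomial, hψ]

theorem Polynomial.coeff_mapAddMonoidHom {A B : Type*} [CommRing A] [CommRing B]
    (ψ : B →+ A) (p : Polynomial B) (n : ℕ) :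
    (Polynomial.mapAddMonoidHom ψ p).coeff n = ψ (p.coeff n) := by
  induction p using Polynomial.induction_on' with
  | add p q hp hq => simp only [map_add, Polynomial.coeff_add, hp, hq]
  | monomial m b =>
    rw [Polynomial.mapAddMonoidHom_monomial, Polynomial.coeff_monomial, Polynomial.coeff_monomial]
    split_ifs <;> simp

theorem Polynomial.mapAddMonoidHom_map_C {σ A B : Type*} [CommRing A] [CommRing B]
    (ψ : B →+ A) (p : Polynomial B) :
    Polynomial.mapAddMonoidHom (MvPolynomial.mapAddMonoidHom (σ := σ) ψ)
        (p.map MvPolynomial.C) =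
      (Polynomial.mapAddMonoidHom ψ p).map MvPolynomial.C := by
  ext1 n
  simp only [Polynomial.coeff_mapAddMonoidHom, Polynomial.coeff_map]
  exact MvPolynomial.mapAddMonoidHom_monomial ψ 0 _

theorem Polynomial.mem_of_forall_map_coord_mem {ι A B : Type*} [CommRing A] [CommRing B]
    [Algebra A B] (b : Module.Basis ι A B) (S : Ideal (Polynomial B)) (p : Polynomial B)
    (h : ∀ i, (Polynomial.mapAddMonoidHom (b.coord i).toAddMonoidHom p).map (algebraMap A B) ∈ S) :
    p ∈ S := by
  classical
  let s := p.support.biUnion fun n => (b.repr (p.coeff n)).support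
  have hp : p = ∑ i ∈ s, Polynomial.C (b i) *
      (Polynomial.mapAddMonoidHom (b.coord i).toAddMonoidHom p).map (algebraMap A B) := by
    ext n
    have hs : (b.repr (p.coeff n)).support ⊆ s := by
      by_cases hn : p.coeff n = 0
      · simp [hn]
      · exact Finset.subset_biUnion_of_mem (fun n => (b.repr (p.coeff n)).support)
          (Polynomial.mem_support_iff.mpr hn)
    conv_lhs => rw [← b.linearCombination_repr (p.coeff n), Finsupp.linearCombination_apply,
      Finsupp.sum_of_support_subset _ hs _ (by simp)]
    simp [Polynomial.coeff_mapAddMonoidHom, Algebra.smul_def,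
      mul_comm]
  rw [hp]
  exact S.sum_mem fun i _ => S.mul_mem_left _ (h i)

/-- Base change commutes with intersecting with the constant-coefficient subring:
`L ⊗_K J ∩ L[s]` equals the ideal of `L[s]` generated by the image of `J ∩ K[s]`. -/
theorem stmt_7 (K L : Type*) [Field K] [CharZero K] [Field L] [Algebra K L] (n : ℕ)
    (J : Ideal (Polynomial (MvPolynomial (Fin n) K))) :
    ∀ g : Polynomial L,
      Polynomial.map (MvPolynomial.C : L →+* MvPolynomial (Fin n) L) g ∈
          J.map (Polynomial.mapRingHom (MvPolynomial.map (algebraMap K L))) ↔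
        g ∈ Ideal.span
          ((fun f => Polynomial.map (algebraMap K L) f) ''
            {f : Polynomial K |
              Polynomial.map (MvPolynomial.C : K →+* MvPolynomial (Fin n) K) f ∈ J}) := by
  intro g
  constructor
  · intro hg
    let b := Module.Basis.ofVectorSpace K L
    refine Polynomial.mem_of_forall_map_coord_mem b _ g fun i =>
      Ideal.subset_span ⟨_, ?_, rfl⟩
    have hcoord : ∀ a c, (b.coord i).toAddMonoidHom (c * algebraMap K L a) =
        (b.coord i).toAddMonoidHom c * a := fun a c => by
      simp [mul_comm c, ← Algebra.smul_def, mul_comm a]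
    rw [Set.mem_ofPred_eq, ← Polynomial.mapAddMonoidHom_map_C]
    refine Ideal.apply_mem_of_mem_map_of_linear_along
      (Polynomial.mapRingHom (MvPolynomial.map (algebraMap K L)))
      (Polynomial.mapAddMonoidHom (MvPolynomial.mapAddMonoidHom (b.coord i).toAddMonoidHom))
      (fun q p => ?_) J hg
    rw [Polynomial.coe_mapRingHom]
    exact Polynomial.mapAddMonoidHom_mul_map (MvPolynomial.map (algebraMap K L)) _
      (MvPolynomial.mapAddMonoidHom_mul_map (algebraMap K L) _ hcoord) q p
  · intro hg
    rw [← Polynomial.coe_mapRingHom, ← Ideal.mem_comap]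
    refine Ideal.span_le.mpr ?_ hg
    rintro _ ⟨f, hf, rfl⟩
    have := Ideal.mem_map_of_mem
      (Polynomial.mapRingHom (MvPolynomial.map (algebraMap K L))) hf
    simpa [Polynomial.map_map, MvPolynomial.map_comp_C] using this
end

section
/- Let K be a field of characteristic zero, L an extension field of K, n a natural number, and J an ideal of K[x][s]. Let 𝔭 be a prime ideal of K[x] and 𝔮 a prime ideal of L[x] whose preimage under the base-change map K[x] → L[x] equals 𝔭. Then: (a) there exists an element of J whose leading coefficient with respect to s lies outside 𝔭 if and only if there exists an element of J_L whose leading coefficient with respect to s lies outside 𝔮; and (b) if f ∈ J has leading coefficient (with respect to s) outside 𝔭 and the s-degree of f is minimal among all elements of J with leading coefficient outside 𝔭, then the image of f in J_L has leading coefficient outside 𝔮 and its s-degree is minimal among all elements of J_L with leading coefficient outside 𝔮. (Hence an indicial polynomial of J at 𝔭, regarded in the localization at 𝔮, is an indicial polynomial of J_L at 𝔮: indicial polynomials are stable under field extension.) -/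
open Polynomial in
/-- Applying a linear functional coefficientwise sends the extension of an ideal back to it. -/
theorem exists_mem_coeff_eq_of_mem_map {A B : Type*} [CommRing A] [CommRing B] [Algebra A B]
    (φ : B →ₗ[A] A) {J : Ideal A[X]} {g : B[X]} (hg : g ∈ J.map (mapRingHom (algebraMap A B))) :
    ∃ f ∈ J, ∀ k, f.coeff k = φ (g.coeff k) := by
  induction hg using Submodule.closure_induction with
  | zero => exact ⟨0, J.zero_mem, by simp⟩
  | add x y _ _ hx hy =>
    obtain ⟨f₁, h₁, e₁⟩ := hx
    obtain ⟨f₂, h₂, e₂⟩ := hy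
    exact ⟨f₁ + f₂, J.add_mem h₁ h₂, by simp [e₁, e₂]⟩
  | smul_mem a x hx =>
    obtain ⟨j, hj, rfl⟩ := hx
    induction a using Polynomial.induction_on' with
    | add p q hp hq =>
      obtain ⟨f₁, h₁, e₁⟩ := hp
      obtain ⟨f₂, h₂, e₂⟩ := hq
      exact ⟨f₁ + f₂, J.add_mem h₁ h₂, by simp [e₁, e₂, add_mul]⟩
    | monomial m b =>
      refine ⟨C (φ b) * (X ^ m * j), J.mul_mem_left _ (J.mul_mem_left _ hj), fun k => ?_⟩
      have hmap : X ^ m * mapRingHom (algebraMap A B) j = (X ^ m * j).map (algebraMap A B) := by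
        simp
      rw [smul_eq_mul, ← C_mul_X_pow_eq_monomial, mul_assoc, hmap, coeff_C_mul, coeff_C_mul,
        coeff_map, mul_comm b, ← Algebra.smul_def, map_smul, smul_eq_mul, mul_comm]

open Polynomial in
/-- Extending scalars along a free algebra does not create smaller degrees of elements of an ideal
whose leading coefficient avoids a given ideal. -/
theorem exists_mem_leadingCoeff_notMem_of_mem_map {A B : Type*} [CommRing A] [CommRing B]
    [Algebra A B] [Module.Free A B] {J : Ideal A[X]} {𝔮 : Ideal B} {g : B[X]}
    (hg : g ∈ J.map (mapRingHom (algebraMap A B))) (hgq : g.leadingCoeff ∉ 𝔮) :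
    ∃ f ∈ J, f.leadingCoeff ∉ 𝔮.comap (algebraMap A B) ∧ f.natDegree ≤ g.natDegree := by
  let b := Module.Free.chooseBasis A B
  obtain ⟨i, hi⟩ : ∃ i, b.coord i g.leadingCoeff ∉ 𝔮.comap (algebraMap A B) := by
    by_contra! h
    refine hgq ?_
    rw [← b.linearCombination_repr g.leadingCoeff, Finsupp.linearCombination_apply]
    refine 𝔮.sum_mem fun i _ => ?_
    simp only [Algebra.smul_def]
    exact 𝔮.mul_mem_right _ (h i)
  obtain ⟨f, hfJ, hf⟩ := exists_mem_coeff_eq_of_mem_map (b.coord i) hg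
  have hle : f.natDegree ≤ g.natDegree :=
    natDegree_le_iff_coeff_eq_zero.2 fun k hk => by
      rw [hf, coeff_eq_zero_of_natDegree_lt hk, map_zero]
  have hi' : f.coeff g.natDegree ∉ 𝔮.comap (algebraMap A B) := by rwa [hf]
  have hdeg : f.natDegree = g.natDegree :=
    hle.antisymm (le_natDegree_of_ne_zero fun h => hi' (h ▸ Ideal.zero_mem _))
  exact ⟨f, hfJ, by rwa [leadingCoeff, hdeg], hle⟩

attribute [local instance] MvPolynomial.algebraMvPolynomial in
theorem MvPolynomial.free_of_free (σ R S : Type*) [CommRing R] [CommRing S] [Algebra R S]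
    [Module.Free R S] : Module.Free (MvPolynomial σ R) (MvPolynomial σ S) :=
  (Algebra.IsPushout.out (R := R) (S := MvPolynomial σ R) (R' := S)
    (S' := MvPolynomial σ S)).free

/-- Indicial polynomials are stable under field extension.  For a prime ideal `𝔭` of
`K[x]` and a prime ideal `𝔮` of `L[x]` lying over `𝔭`: (a) `J` has an element whose
`s`-leading coefficient lies outside `𝔭` iff `J_L` has one with `s`-leading coefficient
outside `𝔮`; (b) an element of `J` with leading coefficient outside `𝔭` and of minimal
`s`-degree among such maps to an element of `J_L` with leading coefficient outside `𝔮`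
and of minimal `s`-degree among such. -/
theorem stmt_8 (K L : Type*) [Field K] [CharZero K] [Field L] [Algebra K L] (n : ℕ)
    (J : Ideal (Polynomial (MvPolynomial (Fin n) K)))
    (𝔭 : Ideal (MvPolynomial (Fin n) K)) (h𝔭 : 𝔭.IsPrime)
    (𝔮 : Ideal (MvPolynomial (Fin n) L)) (h𝔮 : 𝔮.IsPrime)
    (hcomap : 𝔮.comap (MvPolynomial.map (algebraMap K L)) = 𝔭) :
    ((∃ f ∈ J, f.leadingCoeff ∉ 𝔭) ↔
      (∃ g ∈ J.map (Polynomial.mapRingHom (MvPolynomial.map (algebraMap K L))),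
        g.leadingCoeff ∉ 𝔮)) ∧
    (∀ f ∈ J, f.leadingCoeff ∉ 𝔭 →
      (∀ g ∈ J, g.leadingCoeff ∉ 𝔭 → f.natDegree ≤ g.natDegree) →
      (Polynomial.map (MvPolynomial.map (algebraMap K L)) f).leadingCoeff ∉ 𝔮 ∧
        ∀ g ∈ J.map (Polynomial.mapRingHom (MvPolynomial.map (algebraMap K L))),
          g.leadingCoeff ∉ 𝔮 →
          (Polynomial.map (MvPolynomial.map (algebraMap K L)) f).natDegree ≤
            g.natDegree) := by
  let _ : Algebra (MvPolynomial (Fin n) K) (MvPolynomial (Fin n) L) :=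
    MvPolynomial.algebraMvPolynomial
  have := MvPolynomial.free_of_free (Fin n) K L
  subst hcomap
  have descend := fun g hg hgq => exists_mem_leadingCoeff_notMem_of_mem_map
    (A := MvPolynomial (Fin n) K) (J := J) (𝔮 := 𝔮) (g := g) hg hgq
  have map_deg : ∀ f : Polynomial (MvPolynomial (Fin n) K),
      f.leadingCoeff ∉ 𝔮.comap (MvPolynomial.map (algebraMap K L)) →
      (f.map (MvPolynomial.map (algebraMap K L))).leadingCoeff ∉ 𝔮 ∧
        (f.map (MvPolynomial.map (algebraMap K L))).natDegree = f.natDegree := by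
    intro f hf
    have h0 : MvPolynomial.map (algebraMap K L) f.leadingCoeff ≠ 0 := fun h =>
      hf (by rw [Ideal.mem_comap, h]; exact 𝔮.zero_mem)
    rw [Polynomial.leadingCoeff_map_of_leadingCoeff_ne_zero _ h0]
    exact ⟨hf, Polynomial.natDegree_map_of_leadingCoeff_ne_zero _ h0⟩
  refine ⟨⟨fun ⟨f, hfJ, hf⟩ => ⟨_, Ideal.mem_map_of_mem _ hfJ, (map_deg f hf).1⟩, ?_⟩, ?_⟩
  · rintro ⟨g, hg, hgq⟩
    obtain ⟨f, hfJ, hf, -⟩ := descend g hg hgq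
    exact ⟨f, hfJ, hf⟩
  · intro f _ hf hmin
    refine ⟨(map_deg f hf).1, fun g hg hgq => ?_⟩
    obtain ⟨f', hfJ', hf', hle⟩ := descend g hg hgq
    rw [(map_deg f hf).2]
    exact (hmin f' hfJ' hf').trans hle
end

section
/- Let K be a field of characteristic zero, L an extension field of K, n a natural number, J an ideal of K[x][s], and k a natural number. Define I_k(J) := {a ∈ K[x] : there exists f ∈ J whose degree in s is at most k and whose coefficient of s^k equals a}; this is an ideal of K[x], and I_k(J_L) ⊆ L[x] is defined in the same way from J_L. Then I_k(J_L) equals the ideal of L[x] generated by the image of I_k(J) under the base-change map K[x] → L[x]. -/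
open Polynomial in
/-- Apply an additive map to every coefficient of a polynomial. -/
noncomputable def Polynomial.mapCoeff {A B : Type*} [Semiring A] [Semiring B]
    (φ : B →+ A) (p : B[X]) : A[X] :=
  ∑ i ∈ p.support, monomial i (φ (p.coeff i))

open Polynomial in
theorem Polynomial.coeff_mapCoeff {A B : Type*} [Semiring A] [Semiring B]
    (φ : B →+ A) (p : B[X]) (i : ℕ) : (p.mapCoeff φ).coeff i = φ (p.coeff i) := by
  have h : p.coeff i = 0 → φ (p.coeff i) = 0 := fun h => by rw [h, map_zero]
  simpa [mapCoeff, coeff_monomial, eq_comm] using h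

open Polynomial in
theorem Polynomial.natDegree_mapCoeff_le {A B : Type*} [Semiring A] [Semiring B]
    (φ : B →+ A) (p : B[X]) : (p.mapCoeff φ).natDegree ≤ p.natDegree := by
  refine natDegree_le_iff_coeff_eq_zero.2 fun i hi => ?_
  rw [coeff_mapCoeff, coeff_eq_zero_of_natDegree_lt hi, map_zero]

open Polynomial in
theorem Polynomial.mapCoeff_mul_map {A B : Type*} [CommSemiring A] [Semiring B] [Algebra A B]
    (φ : B →ₗ[A] A) (p : B[X]) (q : A[X]) :
    (p * q.map (algebraMap A B)).mapCoeff φ.toAddMonoidHom =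
      p.mapCoeff φ.toAddMonoidHom * q := by
  ext i
  simp only [coeff_mapCoeff, coeff_mul, coeff_map, map_sum, LinearMap.toAddMonoidHom_coe]
  refine Finset.sum_congr rfl fun x _ => ?_
  rw [← Algebra.commutes, ← Algebra.smul_def, map_smul, smul_eq_mul, mul_comm]

open Polynomial in
/-- Coefficientwise application of a linear functional `B → A` sends the extension of an ideal
of `A[X]` to `B[X]` back into the ideal. -/
theorem Ideal.mapCoeff_mem_of_mem_map {A B : Type*} [CommRing A] [CommRing B] [Algebra A B]
    (φ : B →ₗ[A] A) {J : Ideal A[X]} {f : B[X]}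
    (hf : f ∈ J.map (mapRingHom (algebraMap A B))) : f.mapCoeff φ.toAddMonoidHom ∈ J := by
  suffices ∀ g : B[X], (g * f).mapCoeff φ.toAddMonoidHom ∈ J by simpa using this 1
  induction hf using Submodule.span_induction with
  | mem f hf =>
    obtain ⟨h, hh, rfl⟩ := hf
    intro g
    rw [coe_mapRingHom, mapCoeff_mul_map]
    exact J.mul_mem_left _ hh
  | zero => simp [mapCoeff]
  | add f₁ f₂ _ _ h₁ h₂ =>
    intro g
    convert J.add_mem (h₁ g) (h₂ g)
    ext i
    simp [coeff_mapCoeff, mul_add]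
  | smul r f _ hf =>
    intro g
    rw [smul_eq_mul, ← mul_assoc]
    exact hf (g * r)

open Polynomial in
theorem Ideal.mem_leadingCoeffNth_iff_coeff {A : Type*} [CommSemiring A] (I : Ideal A[X])
    (k : ℕ) (a : A) :
    a ∈ I.leadingCoeffNth k ↔ ∃ f ∈ I, f.natDegree ≤ k ∧ f.coeff k = a := by
  simp only [leadingCoeffNth, degreeLE, Submodule.mem_map, lcoeff_apply, Submodule.mem_inf,
    mem_degreeLE, mem_ofPolynomial, natDegree_le_iff_degree_le]
  grind

open Polynomial in
/-- The ideals of top-degree coefficients commute with free extensions of the coefficient ring. -/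
theorem Ideal.leadingCoeffNth_map_of_free {A B : Type*} [CommRing A] [CommRing B] [Algebra A B]
    [Module.Free A B] (J : Ideal A[X]) (k : ℕ) :
    (J.map (mapRingHom (algebraMap A B))).leadingCoeffNth k =
      (J.leadingCoeffNth k).map (algebraMap A B) := by
  refine le_antisymm (fun a ha => ?_) (Ideal.map_le_iff_le_comap.2 fun a ha => ?_)
  · obtain ⟨f, hf, hfk, rfl⟩ := (mem_leadingCoeffNth_iff_coeff _ _ _).1 ha
    let b := Module.Free.chooseBasis A B
    rw [← b.linearCombination_repr (f.coeff k), Finsupp.linearCombination_apply]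
    refine Ideal.sum_mem _ fun i _ => ?_
    simp only [Algebra.smul_def]
    refine Ideal.mul_mem_right _ _ (Ideal.mem_map_of_mem _ ?_)
    exact (mem_leadingCoeffNth_iff_coeff _ _ _).2 ⟨_, mapCoeff_mem_of_mem_map (b.coord i) hf,
      (natDegree_mapCoeff_le _ _).trans hfk, coeff_mapCoeff _ _ _⟩
  · obtain ⟨f, hf, hfk, rfl⟩ := (mem_leadingCoeffNth_iff_coeff _ _ _).1 ha
    exact (mem_leadingCoeffNth_iff_coeff _ _ _).2 ⟨_, Ideal.mem_map_of_mem _ hf,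
      natDegree_map_le.trans hfk, coeff_map _ _⟩

/-- The ideal `I_k` of top-degree-`k` coefficients commutes with field base change:
`I_k(J_L)` is the ideal of `L[x]` generated by the image of `I_k(J)` under the
base-change map `K[x] → L[x]`. -/
theorem stmt_9 (K L : Type*) [Field K] [CharZero K] [Field L] [Algebra K L] (n : ℕ)
    (J : Ideal (Polynomial (MvPolynomial (Fin n) K))) (k : ℕ) :
    ∀ a : MvPolynomial (Fin n) L,
      (∃ f ∈ J.map (Polynomial.mapRingHom (MvPolynomial.map (algebraMap K L))),
        f.natDegree ≤ k ∧ f.coeff k = a) ↔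
      a ∈ Ideal.span
        ((fun a' => MvPolynomial.map (algebraMap K L) a') ''
          {a' : MvPolynomial (Fin n) K | ∃ f ∈ J, f.natDegree ≤ k ∧ f.coeff k = a'}) := by
  intro a
  let := MvPolynomial.algebraMvPolynomial (σ := Fin n) (R := K) (S := L)
  have := MvPolynomial.free_of_free (Fin n) K L
  have h := Ideal.leadingCoeffNth_map_of_free (B := MvPolynomial (Fin n) L) J k
  have hI : {a' | ∃ f ∈ J, f.natDegree ≤ k ∧ f.coeff k = a'} = (J.leadingCoeffNth k : Set _) :=
    Set.ext fun a' => (J.mem_leadingCoeffNth_iff_coeff k a').symm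
  rw [hI, ← Ideal.mem_leadingCoeffNth_iff_coeff]
  exact iff_of_eq (congrArg (a ∈ ·) h)
end

section
/- Let L be a field of characteristic zero, n a natural number, 𝔭 a prime ideal of L[x], R the localization of L[x] at 𝔭, and κ(𝔭) its residue field, which is an L-algebra via L → L[x] → R → κ(𝔭). Let J be an ideal of R[s]. Suppose b ∈ L[s] is monic and its coefficientwise image in R[s] belongs to J (the b-function at 𝔭 exists). Then there exists a monic element b̃ of J of minimal degree among the monic elements of J, and for any such b̃: the image of b̃ in κ(𝔭)[s] divides the image of b in κ(𝔭)[s], and every coefficient of the image of b̃ in κ(𝔭)[s] is algebraic over L. -/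
open Polynomial in
/-- A polynomial of degree less than `d` with coefficients in `I` lies in `I • R[X]_{< d}`. -/
theorem Polynomial.mem_smul_degreeLT_of_coeff_mem {R : Type*} [CommRing R] (I : Ideal R)
    {d : ℕ} {p : R[X]} (hd : p.degree < d) (hp : ∀ i, p.coeff i ∈ I) :
    p ∈ I • degreeLT R d := by
  rw [← p.sum_monomial_eq, Polynomial.sum]
  refine Submodule.sum_mem _ fun i hi => ?_
  rw [← mul_one (p.coeff i), ← smul_eq_mul, ← smul_monomial]
  refine Submodule.smul_mem_smul (hp i) (mem_degreeLT.mpr ?_)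
  exact (degree_monomial_le _ _).trans_lt ((le_degree_of_mem_supp i hi).trans_lt hd)

open Polynomial IsLocalRing in
/-- If an ideal `J` of `R[X]`, `R` local, contains a monic polynomial `p`, then any `r ∈ J` whose
reduction is nonzero of degree smaller than that of `p` yields a monic element of `J` of the same
degree as the reduction of `r`. -/
theorem IsLocalRing.exists_monic_mem_natDegree_eq {R : Type*} [CommRing R] [IsLocalRing R]
    (J : Ideal R[X]) {p r : R[X]} (hpJ : p ∈ J) (hp : p.Monic) (hrJ : r ∈ J)
    (hr : r.map (residue R) ≠ 0) (hlt : (r.map (residue R)).natDegree < p.natDegree) :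
    ∃ g ∈ J, g.Monic ∧ g.natDegree = (r.map (residue R)).natDegree := by
  classical
  set e := (r.map (residue R)).natDegree
  obtain ⟨u, hu⟩ := residue_surjective (R := R) (r.map (residue R)).leadingCoeff⁻¹
  have hmonic : ((C u * r).map (residue R)).Monic := by
    rw [Polynomial.map_mul, map_C, hu, mul_comm]
    exact monic_mul_leadingCoeff_inv hr
  obtain ⟨r₀, hr₀, hr₀deg, hr₀m⟩ := lifts_and_natDegree_eq_and_monic
    (f := residue R) ((mem_lifts _).mpr ⟨C u * r, rfl⟩) hmonic
  have hr₀e : r₀.natDegree = e := by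
    rw [hr₀deg, Polynomial.map_mul, map_C, hu, mul_comm,
      natDegree_mul_leadingCoeff_inv _ hr]
  have key : degreeLT R p.natDegree ≤ J.restrictScalars R ⊔ degreeLT R e := by
    refine Submodule.le_of_le_smul_of_le_jacobson_bot (I := maximalIdeal R)
      (by rw [degreeLT_eq_span_X_pow]; exact ⟨_, rfl⟩) (maximalIdeal_le_jacobson _) ?_
    intro f _
    set w := ((r₀ - C u * r) * (f /ₘ r₀)) %ₘ p with hw
    have hwdeg : w.degree < p.natDegree :=
      (degree_modByMonic_lt _ hp).trans_le degree_le_natDegree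
    have hwmap : w.map (residue R) = 0 := by
      rw [hw, map_modByMonic _ hp, Polynomial.map_mul, Polynomial.map_sub, hr₀, sub_self,
        zero_mul, zero_modByMonic]
    have hwmem : w ∈ maximalIdeal R • degreeLT R p.natDegree :=
      mem_smul_degreeLT_of_coeff_mem _ hwdeg fun i => by
        rw [← residue_eq_zero_iff, ← coeff_map, hwmap, coeff_zero]
    have hrem : f %ₘ r₀ ∈ degreeLT R e := mem_degreeLT.mpr <| by
      rw [← hr₀e, ← degree_eq_natDegree hr₀m.ne_zero]
      exact degree_modByMonic_lt _ hr₀m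
    have hJ : C u * r * (f /ₘ r₀) + p * (((r₀ - C u * r) * (f /ₘ r₀)) /ₘ p) ∈
        J.restrictScalars R :=
      J.add_mem (J.mul_mem_right _ (J.mul_mem_left _ hrJ)) (J.mul_mem_right _ hpJ)
    have hf : f = C u * r * (f /ₘ r₀) + p * (((r₀ - C u * r) * (f /ₘ r₀)) /ₘ p)
        + f %ₘ r₀ + w := by
      have h₁ := modByMonic_add_div f r₀
      have h₂ := modByMonic_add_div ((r₀ - C u * r) * (f /ₘ r₀)) p
      linear_combination -h₁ - h₂
    rw [hf]
    exact Submodule.add_mem_sup (Submodule.add_mem_sup hJ hrem) hwmem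
  have hX : (X ^ e : R[X]) ∈ degreeLT R p.natDegree := mem_degreeLT.mpr <| by
    rw [degree_X_pow]; exact_mod_cast hlt
  obtain ⟨g, hg, h, hh, hgh⟩ := Submodule.mem_sup.mp (key hX)
  have hheq : g = X ^ e + -h := by rw [← hgh, add_neg_cancel_right]
  have hhdeg : (-h).degree < (e : WithBot ℕ) := by rw [degree_neg]; exact mem_degreeLT.mp hh
  refine ⟨g, hg, hheq ▸ monic_X_pow_add hhdeg, ?_⟩
  apply natDegree_eq_of_degree_eq_some
  rw [hheq, degree_add_eq_left_of_degree_lt (by rwa [degree_X_pow]), degree_X_pow]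

open Polynomial IsLocalRing in
/-- The reduction of a monic element of minimal degree of an ideal `J` of `R[X]`, `R` local,
divides the reduction of every element of `J`. -/
theorem IsLocalRing.map_residue_dvd_of_minimal_monic {R : Type*} [CommRing R] [IsLocalRing R]
    (J : Ideal R[X]) {p f : R[X]} (hpJ : p ∈ J) (hp : p.Monic)
    (hmin : ∀ g ∈ J, g.Monic → p.degree ≤ g.degree) (hf : f ∈ J) :
    p.map (residue R) ∣ f.map (residue R) := by
  rw [← modByMonic_eq_zero_iff_dvd (hp.map _), ← map_modByMonic _ hp]
  by_contra hne
  have hrJ : f %ₘ p ∈ J := by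
    rw [modByMonic_eq_sub_mul_div]
    exact J.sub_mem hf (J.mul_mem_right _ hpJ)
  have hlt : ((f %ₘ p).map (residue R)).natDegree < p.natDegree := by
    refine (natDegree_lt_iff_degree_lt hne).mpr ?_
    exact degree_map_le.trans_lt ((degree_modByMonic_lt _ hp).trans_le degree_le_natDegree)
  obtain ⟨g, hgJ, hg, hdeg⟩ := exists_monic_mem_natDegree_eq J hpJ hp hrJ hne hlt
  exact (natDegree_le_natDegree (hmin g hgJ hg)).not_gt (hdeg ▸ hlt)


/-- If the b-function of `J` at a prime `𝔭` exists (a monic `b ∈ L[s]` whose image in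
`R[s]`, `R = L[x]_𝔭`, lies in `J`), then an indicial polynomial `b̃` of `J` at `𝔭`
exists, and for any such `b̃` its image in `κ(𝔭)[s]` divides the image of `b` and has
all coefficients algebraic over `L`. -/
theorem stmt_12 (L : Type*) [Field L] [CharZero L] (n : ℕ)
    (𝔭 : Ideal (MvPolynomial (Fin n) L)) [𝔭.IsPrime]
    (J : Ideal (Polynomial (Localization.AtPrime 𝔭)))
    (b : Polynomial L) (hb : b.Monic)
    (hbJ : Polynomial.map
      ((algebraMap (MvPolynomial (Fin n) L) (Localization.AtPrime 𝔭)).comp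
        (MvPolynomial.C : L →+* MvPolynomial (Fin n) L)) b ∈ J) :
    (∃ bt ∈ J, bt.Monic ∧ ∀ g ∈ J, g.Monic → bt.degree ≤ g.degree) ∧
    ∀ bt ∈ J, bt.Monic → (∀ g ∈ J, g.Monic → bt.degree ≤ g.degree) →
      (Polynomial.map (IsLocalRing.residue (Localization.AtPrime 𝔭)) bt ∣
        Polynomial.map
          ((IsLocalRing.residue (Localization.AtPrime 𝔭)).comp
            ((algebraMap (MvPolynomial (Fin n) L) (Localization.AtPrime 𝔭)).comp
              (MvPolynomial.C : L →+* MvPolynomial (Fin n) L))) b) ∧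
      ∀ i : ℕ, ∃ q : Polynomial L, q ≠ 0 ∧
        Polynomial.eval₂
          ((IsLocalRing.residue (Localization.AtPrime 𝔭)).comp
            ((algebraMap (MvPolynomial (Fin n) L) (Localization.AtPrime 𝔭)).comp
              (MvPolynomial.C : L →+* MvPolynomial (Fin n) L)))
          ((Polynomial.map (IsLocalRing.residue (Localization.AtPrime 𝔭)) bt).coeff i)
          q = 0 := by
  constructor
  · obtain ⟨bt, ⟨hJ, hm⟩, hmin⟩ := exists_minimalFor_of_wellFoundedLT
      (fun g : Polynomial (Localization.AtPrime 𝔭) => g ∈ J ∧ g.Monic) Polynomial.degree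
      ⟨_, hbJ, hb.map _⟩
    exact ⟨bt, hJ, hm, fun g hg hgm => (le_total bt.degree g.degree).elim id
      (hmin ⟨hg, hgm⟩)⟩
  · intro bt hbt hm hmin
    have hdvd := IsLocalRing.map_residue_dvd_of_minimal_monic J hbt hm hmin hbJ
    rw [Polynomial.map_map] at hdvd
    refine ⟨hdvd, fun i => ?_⟩
    let := ((IsLocalRing.residue (Localization.AtPrime 𝔭)).comp
      ((algebraMap (MvPolynomial (Fin n) L) (Localization.AtPrime 𝔭)).comp
        (MvPolynomial.C : L →+* MvPolynomial (Fin n) L))).toAlgebra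
    obtain ⟨q, hq, hq0⟩ := Polynomial.isIntegral_coeff_of_dvd b
      (bt.map (IsLocalRing.residue (Localization.AtPrime 𝔭))) hb (hm.map _) hdvd i
    exact ⟨q, hq.ne_zero, hq0⟩
end

section
/- Let Ω be an algebraically closed field of characteristic zero, L a field equipped with an algebra map L → Ω (a subfield of Ω), n a natural number, p ∈ Ω^n, and J an ideal of L[x][s]. Suppose f ∈ J has leading coefficient with respect to s outside the prime ideal Z_L(p) of L[x], and the s-degree of f is minimal among all elements of J with leading coefficient outside Z_L(p). Then the image of f in J_Ω has leading coefficient outside the maximal ideal Z_Ω(p) of Ω[x], and its s-degree is minimal among all elements of J_Ω with leading coefficient outside Z_Ω(p). (Hence an indicial polynomial of J at Z_L(p) is also an indicial polynomial of J_Ω at the maximal ideal Z_Ω(p).) -/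
/-- Apply an `L`-linear functional on an extension to the coefficients of a polynomial. -/
noncomputable def MvPolynomial.mapFunctional {σ L Ω : Type*} [CommSemiring L] [CommSemiring Ω]
    [Algebra L Ω] (φ : Ω →ₗ[L] L) (c : MvPolynomial σ Ω) : MvPolynomial σ L :=
  ∑ m ∈ c.support, MvPolynomial.monomial m (φ (c.coeff m))

/-- Apply an `L`-linear functional on an extension to the scalar coefficients of a univariate
polynomial with multivariate polynomial coefficients. -/
noncomputable def Polynomial.mapFunctional {σ L Ω : Type*} [CommSemiring L] [CommSemiring Ω]
    [Algebra L Ω] (φ : Ω →ₗ[L] L) (g : Polynomial (MvPolynomial σ Ω)) :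
    Polynomial (MvPolynomial σ L) :=
  ∑ k ∈ g.support, Polynomial.monomial k ((g.coeff k).mapFunctional φ)

section

variable {σ L Ω : Type*}

section CommSemiring

variable [CommSemiring L] [CommSemiring Ω] [Algebra L Ω]

theorem MvPolynomial.coeff_mapFunctional (φ : Ω →ₗ[L] L) (c : MvPolynomial σ Ω) (m : σ →₀ ℕ) :
    (c.mapFunctional φ).coeff m = φ (c.coeff m) := by
  classical
  simp only [mapFunctional, coeff_sum, coeff_monomial, Finset.sum_ite_eq', mem_support_iff]
  split_ifs with h
  · rfl
  · rw [not_not.mp h, map_zero]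

theorem Polynomial.coeff_mapFunctional (φ : Ω →ₗ[L] L) (g : Polynomial (MvPolynomial σ Ω))
    (k : ℕ) : (g.mapFunctional φ).coeff k = (g.coeff k).mapFunctional φ := by
  classical
  simp only [mapFunctional, finsetSum_coeff, coeff_monomial, Finset.sum_ite_eq', mem_support_iff]
  split_ifs with h
  · rfl
  · rw [not_not.mp h]
    simp [MvPolynomial.mapFunctional]

theorem MvPolynomial.mapFunctional_add (φ : Ω →ₗ[L] L) (c d : MvPolynomial σ Ω) :
    (c + d).mapFunctional φ = c.mapFunctional φ + d.mapFunctional φ := by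
  ext m
  simp [coeff_mapFunctional]

theorem MvPolynomial.mapFunctional_sum {ι : Type*} (φ : Ω →ₗ[L] L) (s : Finset ι)
    (c : ι → MvPolynomial σ Ω) :
    (∑ i ∈ s, c i).mapFunctional φ = ∑ i ∈ s, (c i).mapFunctional φ := by
  ext m
  simp [coeff_mapFunctional, coeff_sum]

theorem MvPolynomial.mapFunctional_mul_map (φ : Ω →ₗ[L] L) (c : MvPolynomial σ Ω)
    (q : MvPolynomial σ L) :
    (c * map (algebraMap L Ω) q).mapFunctional φ = c.mapFunctional φ * q := by
  classical
  ext m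
  simp only [coeff_mapFunctional, coeff_mul, coeff_map, map_sum]
  refine Finset.sum_congr rfl fun x _ => ?_
  rw [mul_comm, ← Algebra.smul_def, map_smul, smul_eq_mul, mul_comm]

theorem Polynomial.mapFunctional_add (φ : Ω →ₗ[L] L) (g h : Polynomial (MvPolynomial σ Ω)) :
    (g + h).mapFunctional φ = g.mapFunctional φ + h.mapFunctional φ := by
  ext1 k
  simp [coeff_mapFunctional, MvPolynomial.mapFunctional_add]

theorem Polynomial.mapFunctional_mul_map (φ : Ω →ₗ[L] L) (g : Polynomial (MvPolynomial σ Ω))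
    (j : Polynomial (MvPolynomial σ L)) :
    (g * map (MvPolynomial.map (algebraMap L Ω)) j).mapFunctional φ = g.mapFunctional φ * j := by
  ext1 k
  simp only [coeff_mapFunctional, coeff_mul, coeff_map, MvPolynomial.mapFunctional_sum,
    MvPolynomial.mapFunctional_mul_map]

theorem Polynomial.natDegree_mapFunctional_le (φ : Ω →ₗ[L] L)
    (g : Polynomial (MvPolynomial σ Ω)) : (g.mapFunctional φ).natDegree ≤ g.natDegree := by
  refine natDegree_le_iff_coeff_eq_zero.mpr fun k hk => ?_
  rw [coeff_mapFunctional, coeff_eq_zero_of_natDegree_lt hk]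
  simp [MvPolynomial.mapFunctional]

end CommSemiring

theorem Polynomial.mapFunctional_mem [CommRing L] [CommRing Ω] [Algebra L Ω] (φ : Ω →ₗ[L] L)
    {J : Ideal (Polynomial (MvPolynomial σ L))} {g : Polynomial (MvPolynomial σ Ω)}
    (hg : g ∈ J.map (mapRingHom (MvPolynomial.map (algebraMap L Ω)))) :
    g.mapFunctional φ ∈ J := by
  suffices h : ∀ a : Polynomial (MvPolynomial σ Ω), (a * g).mapFunctional φ ∈ J by
    simpa using h 1
  refine Submodule.span_induction (p := fun x _ => ∀ a, (a * x).mapFunctional φ ∈ J)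
    ?_ ?_ ?_ ?_ hg
  · rintro _ ⟨j, hj, rfl⟩ a
    rw [coe_mapRingHom, mapFunctional_mul_map]
    exact J.mul_mem_left _ hj
  · intro a
    simp [mapFunctional]
  · intro x y _ _ hx hy a
    rw [mul_add, mapFunctional_add]
    exact J.add_mem (hx a) (hy a)
  · intro b x _ hx a
    rw [smul_eq_mul, ← mul_assoc]
    exact hx (a * b)

/-- A polynomial over a field extension that does not vanish at `p` has a coordinate
polynomial over the base field that does not vanish at `p`. -/
theorem MvPolynomial.exists_aeval_mapFunctional_ne_zero [Field L] [Field Ω] [Algebra L Ω]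
    (p : σ → Ω) (c : MvPolynomial σ Ω) (hc : eval p c ≠ 0) :
    ∃ φ : Ω →ₗ[L] L, aeval p (c.mapFunctional φ) ≠ 0 := by
  classical
  let b := Module.Free.chooseBasis L Ω
  by_contra! h
  let T := c.support.biUnion fun m => (b.repr (c.coeff m)).support
  have key : ∀ m ∈ c.support, c.coeff m = ∑ i ∈ T, b.coord i (c.coeff m) • b i := by
    intro m hm
    conv_lhs => rw [← b.linearCombination_repr (c.coeff m)]
    refine Finsupp.sum_of_support_subset _
      (Finset.subset_biUnion_of_mem (fun m => (b.repr (c.coeff m)).support) hm) _ (by simp)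
  apply hc
  calc eval p c = ∑ m ∈ c.support, c.coeff m * m.prod fun i k => p i ^ k := by
        simp [eval_eq, Finsupp.prod]
    _ = ∑ m ∈ c.support, (∑ i ∈ T, b.coord i (c.coeff m) • b i) * m.prod fun i k => p i ^ k :=
        Finset.sum_congr rfl fun m hm => by rw [← key m hm]
    _ = ∑ i ∈ T, b i * aeval p (c.mapFunctional (b.coord i)) := by
        simp only [mapFunctional, map_sum, aeval_monomial, Finset.sum_mul, Finset.mul_sum]
        rw [Finset.sum_comm]
        refine Finset.sum_congr rfl fun i _ => Finset.sum_congr rfl fun m _ => ?_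
        rw [Algebra.smul_def]
        ring
    _ = 0 := by simp [h]

end


/-- An indicial polynomial of `J` at `Z_L(p)` is also an indicial polynomial of `J_Ω`
at the maximal ideal `Z_Ω(p)`: if `f ∈ J` has `s`-leading coefficient outside the
kernel of evaluation at `p` over `L` and minimal `s`-degree among such elements, then
its image in `J_Ω` has leading coefficient outside the kernel of evaluation at `p`
over `Ω` and minimal `s`-degree among such elements of `J_Ω`. -/
theorem stmt_15 (Ω L : Type*) [Field Ω] [IsAlgClosed Ω] [CharZero Ω]
    [Field L] [Algebra L Ω] (n : ℕ) (p : Fin n → Ω)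
    (J : Ideal (Polynomial (MvPolynomial (Fin n) L)))
    (f : Polynomial (MvPolynomial (Fin n) L)) (hfJ : f ∈ J)
    (hlc : f.leadingCoeff ∉ RingHom.ker
      ((MvPolynomial.aeval p : MvPolynomial (Fin n) L →ₐ[L] Ω) : MvPolynomial (Fin n) L →+* Ω))
    (hmin : ∀ g ∈ J, g.leadingCoeff ∉ RingHom.ker
        ((MvPolynomial.aeval p : MvPolynomial (Fin n) L →ₐ[L] Ω) : MvPolynomial (Fin n) L →+* Ω) →
      f.natDegree ≤ g.natDegree) :
    (Polynomial.map (MvPolynomial.map (algebraMap L Ω)) f).leadingCoeff ∉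
      RingHom.ker (MvPolynomial.eval p : MvPolynomial (Fin n) Ω →+* Ω) ∧
    ∀ g ∈ J.map (Polynomial.mapRingHom (MvPolynomial.map (algebraMap L Ω))),
      g.leadingCoeff ∉ RingHom.ker (MvPolynomial.eval p : MvPolynomial (Fin n) Ω →+* Ω) →
      (Polynomial.map (MvPolynomial.map (algebraMap L Ω)) f).natDegree ≤ g.natDegree := by
  have hinj : Function.Injective
      (MvPolynomial.map (algebraMap L Ω) : MvPolynomial (Fin n) L →+* MvPolynomial (Fin n) Ω) :=
    MvPolynomial.map_injective _ (algebraMap L Ω).injective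
  rw [Polynomial.leadingCoeff_map_of_injective hinj, Polynomial.natDegree_map_eq_of_injective hinj]
  refine ⟨?_, fun g hg hgp => ?_⟩
  · simpa [RingHom.mem_ker, MvPolynomial.eval_map, MvPolynomial.aeval_def] using hlc
  · obtain ⟨φ, hφ⟩ := MvPolynomial.exists_aeval_mapFunctional_ne_zero (L := L) p _ hgp
    rw [Polynomial.leadingCoeff, ← Polynomial.coeff_mapFunctional] at hφ
    have hdeg : (g.mapFunctional φ).natDegree = g.natDegree :=
      le_antisymm (Polynomial.natDegree_mapFunctional_le φ g)
        (Polynomial.le_natDegree_of_ne_zero fun h => hφ (by rw [h, map_zero]))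
    rw [← hdeg] at hφ ⊢
    exact hmin _ (Polynomial.mapFunctional_mem φ hg) hφ
end
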